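/- Let (A,R) be a minimal triangular pointed Hopf algebra over an algebraically closed field k of characteristic 0, G = G(A), and for g ∈ G let V_g be a ⟨g⟩-stable complement of sp_k{1−g} in P_{1,g}(A). Then for all x ∈ V_g one has x² = 0 and gx = −xg. -/

import Mathlib

open TensorProduct

noncomputable section

universe u v w

namespace Paper

variable (k : Type*) [Field k]

section Basic

variable (A : Type*) [Ring A] [HopfAlgebra k A]

/-- `g` is a grouplike element of the Hopf algebra `A`. -/
def IsGrouplike (g : A) : Prop :=
  Coalgebra.counit (R := k) g = 1 ∧ Coalgebra.comul (R := k) g = g ⊗ₜ[k] g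

/-- `x` is a `g:h` skew primitive element of `A`, i.e. `Δ(x) = x ⊗ g + h ⊗ x`. -/
def IsSkewPrimitive (g h x : A) : Prop :=
  Coalgebra.comul (R := k) x = x ⊗ₜ[k] g + h ⊗ₜ[k] x

/-- The space `P_{g,h}(A)` of `g:h` skew primitives, as a submodule. -/
def skewPrimitives (g h : A) : Submodule k A :=
  LinearMap.ker (Coalgebra.comul (R := k) -
    ((TensorProduct.mk k A A).flip g + TensorProduct.mk k A A h))

end Basic

section Coalg

variable {M : Type*} [AddCommGroup M] [Module k M]

/-- `C` is a subcoalgebra with respect to the comultiplication `d`. -/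
def IsSubcoalgebraOf (d : M →ₗ[k] M ⊗[k] M) (C : Submodule k M) : Prop :=
  ∀ x ∈ C, d x ∈ LinearMap.range (TensorProduct.map C.subtype C.subtype)

/-- `C` is a simple subcoalgebra with respect to `d`. -/
def IsSimpleSubcoalgebraOf (d : M →ₗ[k] M ⊗[k] M) (C : Submodule k M) : Prop :=
  C ≠ ⊥ ∧ IsSubcoalgebraOf k d C ∧
    ∀ D : Submodule k M, IsSubcoalgebraOf k d D → D ≤ C → D = ⊥ ∨ D = C

/-- A coalgebra is pointed if all its simple subcoalgebras are `1`-dimensional. -/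
def IsPointedOf (d : M →ₗ[k] M ⊗[k] M) : Prop :=
  ∀ C : Submodule k M, IsSimpleSubcoalgebraOf k d C → Module.finrank k C = 1

/-- The coradical: the sum of all simple subcoalgebras. -/
def coradicalOf (d : M →ₗ[k] M ⊗[k] M) : Submodule k M :=
  sSup {C | IsSimpleSubcoalgebraOf k d C}

/-- The first term `A₁ = Δ⁻¹(A₀ ⊗ A + A ⊗ A₀)` of the coradical filtration. -/
def firstCoradicalTermOf (d : M →ₗ[k] M ⊗[k] M) : Submodule k M :=
  Submodule.comap d
    (LinearMap.range (TensorProduct.map (coradicalOf k d).subtype (LinearMap.id (M := M))) ⊔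
      LinearMap.range (TensorProduct.map (LinearMap.id (M := M)) (coradicalOf k d).subtype))

end Coalg

section Hopf

variable (A : Type*) [Ring A] [HopfAlgebra k A]

/-- A Hopf algebra is pointed if all its simple subcoalgebras are `1`-dimensional. -/
def IsPointed : Prop := IsPointedOf k (Coalgebra.comul (R := k) (A := A))

/-- A subalgebra `B` of `A` is a sub-Hopf-algebra if it is closed under
comultiplication and under the antipode. -/
def IsSubHopf (B : Subalgebra k A) : Prop :=
  (∀ x ∈ B, Coalgebra.comul (R := k) x ∈
      LinearMap.range (TensorProduct.map B.toSubmodule.subtype B.toSubmodule.subtype)) ∧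
  ∀ x ∈ B, HopfAlgebra.antipode (R := k) x ∈ B

/-- `r` belongs to `K ⊗ K ⊆ A ⊗ A` for a submodule `K` of `A`. -/
def MemTensorSquare (K : Submodule k A) (r : A ⊗[k] A) : Prop :=
  r ∈ LinearMap.range (TensorProduct.map K.subtype K.subtype)

/-- `(Δ ⊗ id)(r) = r₁₃ r₂₃`. -/
def Hexagon₁ (r : A ⊗[k] A) : Prop :=
  Algebra.TensorProduct.map (Bialgebra.comulAlgHom k A) (AlgHom.id k A) r =
    Algebra.TensorProduct.map (Algebra.TensorProduct.includeLeft (R := k) (S := k)) (AlgHom.id k A) r *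
      Algebra.TensorProduct.map (Algebra.TensorProduct.includeRight (R := k)) (AlgHom.id k A) r

/-- `(id ⊗ Δ)(r) = r₁₃ r₁₂`. -/
def Hexagon₂ (r : A ⊗[k] A) : Prop :=
  Algebra.TensorProduct.map (AlgHom.id k A) (Bialgebra.comulAlgHom k A) r =
    Algebra.TensorProduct.map (AlgHom.id k A) (Algebra.TensorProduct.includeRight (R := k)) r *
      Algebra.TensorProduct.map (AlgHom.id k A) (Algebra.TensorProduct.includeLeft (R := k) (S := k)) r

/-- The Drinfeld element `u = Σ S(R⁽²⁾) R⁽¹⁾` associated to an element `r ∈ A ⊗ A`. -/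
def drinfeldOf (r : A ⊗[k] A) : A :=
  LinearMap.mul' k A
    ((TensorProduct.map (HopfAlgebra.antipode (R := k)) LinearMap.id)
      ((TensorProduct.comm k A A) r))

/-- A quasitriangular structure on the Hopf algebra `A`. -/
structure QuasiTriangular where
  /-- the R-matrix -/
  R : A ⊗[k] A
  isUnit : IsUnit R
  intertwine : ∀ a : A,
    (TensorProduct.comm k A A) (Coalgebra.comul (R := k) a) * R = R * Coalgebra.comul (R := k) a
  hexagon₁ : Hexagon₁ k A R
  hexagon₂ : Hexagon₂ k A R

variable {A}

/-- A quasitriangular Hopf algebra is triangular if `R R₂₁ = 1 ⊗ 1`. -/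
def QuasiTriangular.IsTriangular (Q : QuasiTriangular k A) : Prop :=
  Q.R * (TensorProduct.comm k A A) Q.R = 1

/-- `(A,R)` is minimal if no proper sub-Hopf-algebra contains the components of `R`. -/
def QuasiTriangular.IsMinimal (Q : QuasiTriangular k A) : Prop :=
  ∀ B : Subalgebra k A, IsSubHopf k A B → MemTensorSquare k A B.toSubmodule Q.R → B = ⊤

/-- The Drinfeld element of a quasitriangular Hopf algebra. -/
def QuasiTriangular.drinfeld (Q : QuasiTriangular k A) : A := drinfeldOf k A Q.R

/-- The map `f_R : A* → A`, `p ↦ (p ⊗ I)(R)`. -/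
def fR (Q : QuasiTriangular k A) : Module.Dual k A →ₗ[k] A :=
  TensorProduct.lift
    (LinearMap.mk₂ k (fun a b => (Module.Dual.eval k A a).smulRight b)
      (fun a a' b => by ext p; simp [add_smul])
      (fun c a b => by ext p; simp [smul_smul])
      (fun a b b' => by ext p; simp [smul_add])
      (fun c a b => by ext p; simp [smul_comm (p a) c b])) Q.R

/-- Radford's coinvariants `B = {x ∈ A | (I ⊗ π)Δ(x) = x ⊗ 1}` of a projection `π`. -/
def coinvariants (π : A →ₗ[k] A) : Submodule k A :=
  LinearMap.ker
    ((TensorProduct.map LinearMap.id π) ∘ₗ Coalgebra.comul (R := k) -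
      (TensorProduct.mk k A A).flip 1)

end Hopf


section Complements

variable (A : Type*) [Ring A] [HopfAlgebra k A]

/-- Radford's projection `Π : A → B`, `Π(a) = Σ a₁ · S(π(a₂))`, associated to a Hopf
algebra projection `π`; it projects `A` onto the coinvariants `B`. -/
def radfordPi (π : A →ₗ[k] A) : A →ₗ[k] A :=
  LinearMap.mul' k A ∘ₗ
    TensorProduct.map LinearMap.id (HopfAlgebra.antipode (R := k) ∘ₗ π) ∘ₗ
      Coalgebra.comul (R := k)

/-- `π : A → A` is a Hopf algebra projection of `A` onto `K = k[G(A)]`, the span of the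
grouplike elements: it is a coalgebra map, its range is `K` and it restricts to the
identity on `K`. -/
def IsHopfProjectionOntoGrouplikes (π : A →ₐ[k] A) : Prop :=
  (∀ x : A, Coalgebra.comul (R := k) (π x) =
    TensorProduct.map π.toLinearMap π.toLinearMap (Coalgebra.comul (R := k) x)) ∧
  (∀ x : A, Coalgebra.counit (R := k) (π x) = Coalgebra.counit (R := k) x) ∧
  LinearMap.range π.toLinearMap = Submodule.span k {g : A | IsGrouplike k A g} ∧
  (∀ x ∈ Submodule.span k {g : A | IsGrouplike k A g}, π x = x)

/-- `V` is a `⟨g⟩`-stable (under conjugation) complement of `sp_k{1−g}` in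
`P_{1,g}(A)`. -/
def IsConjStableComplement (g : A) (V : Submodule k A) : Prop :=
  V ≤ skewPrimitives k A 1 g ∧
  Disjoint (Submodule.span k {(1 : A) - g}) V ∧
  Submodule.span k {(1 : A) - g} ⊔ V = skewPrimitives k A 1 g ∧
  ∀ x ∈ V, g * x * HopfAlgebra.antipode (R := k) g ∈ V

end Complements

section Slices

variable {k} {A : Type*} [AddCommGroup A] [Module k A]

/-- The slice map `p ⊗ id : A ⊗ A → A` of a functional `p`. -/
def leftSlice (p : Module.Dual k A) : A ⊗[k] A →ₗ[k] A :=
  (TensorProduct.lid k A).toLinearMap ∘ₗ p.rTensor A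

/-- The slice map `id ⊗ p : A ⊗ A → A` of a functional `p`. -/
def rightSlice (p : Module.Dual k A) : A ⊗[k] A →ₗ[k] A :=
  (TensorProduct.rid k A).toLinearMap ∘ₗ p.lTensor A

@[simp] lemma leftSlice_tmul (p : Module.Dual k A) (a b : A) :
    leftSlice p (a ⊗ₜ[k] b) = p a • b := by simp [leftSlice]

@[simp] lemma rightSlice_tmul (p : Module.Dual k A) (a b : A) :
    rightSlice p (a ⊗ₜ[k] b) = p b • a := by simp [rightSlice]

lemma leftSlice_comm (p : Module.Dual k A) (z : A ⊗[k] A) :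
    leftSlice p (TensorProduct.comm k A A z) = rightSlice p z := by
  induction z with
  | zero => simp
  | tmul a b => simp
  | add y z hy hz => simp [hy, hz]

lemma apply_leftSlice (p q : Module.Dual k A) (z : A ⊗[k] A) :
    q (leftSlice p z) = p (rightSlice q z) := by
  induction z with
  | zero => simp
  | tmul a b => simp [mul_comm]
  | add y z hy hz => simp [hy, hz]

lemma ext_rightSlice {y z : A ⊗[k] A} (h : ∀ p : Module.Dual k A, rightSlice p y = rightSlice p z) :
    y = z := by
  let b := Module.Free.chooseBasis k A
  have key (w : A ⊗[k] A) (i) :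
      TensorProduct.equivFinsuppOfBasisRight (M := A) b w i = rightSlice (b.coord i) w := by
    induction w with
    | zero => simp
    | tmul a c => simp
    | add y z hy hz => simp [hy, hz]
  apply (TensorProduct.equivFinsuppOfBasisRight (M := A) b).injective
  ext i
  rw [key, key, h]

lemma ext_leftSlice {y z : A ⊗[k] A} (h : ∀ p : Module.Dual k A, leftSlice p y = leftSlice p z) :
    y = z := by
  apply (TensorProduct.comm k A A).injective
  refine ext_rightSlice fun p => ?_
  have (w : A ⊗[k] A) : rightSlice p (TensorProduct.comm k A A w) = leftSlice p w := by
    rw [← leftSlice_comm, ← LinearEquiv.symm_apply_apply (TensorProduct.comm k A A) w]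
    simp
  rw [this, this, h]

lemma leftSlice_rTensor (p : Module.Dual k A) (f : A →ₗ[k] A) (z : A ⊗[k] A) :
    leftSlice p (f.rTensor A z) = leftSlice (p ∘ₗ f) z := by
  induction z with
  | zero => simp
  | tmul a b => simp
  | add y z hy hz => simp [hy, hz]

lemma rightSlice_rTensor (p : Module.Dual k A) (f : A →ₗ[k] A) (z : A ⊗[k] A) :
    rightSlice p (f.rTensor A z) = f (rightSlice p z) := by
  induction z with
  | zero => simp
  | tmul a b => simp
  | add y z hy hz => simp [hy, hz]

lemma leftSlice_lTensor (p : Module.Dual k A) (f : A →ₗ[k] A) (z : A ⊗[k] A) :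
    leftSlice p (f.lTensor A z) = f (leftSlice p z) := by
  induction z with
  | zero => simp
  | tmul a b => simp
  | add y z hy hz => simp [hy, hz]

/-- A tensor all of whose slices lie in `C` lies in `C ⊗ C`. -/
lemma mem_range_map_subtype {C : Submodule k A} {z : A ⊗[k] A}
    (hl : ∀ p : Module.Dual k A, leftSlice p z ∈ C)
    (hr : ∀ p : Module.Dual k A, rightSlice p z ∈ C) :
    z ∈ LinearMap.range (TensorProduct.map C.subtype C.subtype) := by
  obtain ⟨e, he⟩ := C.subtype.exists_leftInverse_of_injective C.ker_subtype
  have he' (c : A) (hc : c ∈ C) : C.subtype (e c) = c :=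
    congrArg Subtype.val (LinearMap.congr_fun he ⟨c, hc⟩)
  have h1 : (C.subtype ∘ₗ e).rTensor A z = z :=
    ext_rightSlice fun p => by rw [rightSlice_rTensor]; exact he' _ (hr p)
  have h2 : (C.subtype ∘ₗ e).lTensor A z = z :=
    ext_leftSlice fun p => by rw [leftSlice_lTensor]; exact he' _ (hl p)
  refine ⟨TensorProduct.map e e z, ?_⟩
  calc _ = (C.subtype ∘ₗ e).lTensor A ((C.subtype ∘ₗ e).rTensor A z) := by
        rw [← LinearMap.comp_apply, ← LinearMap.comp_apply, ← TensorProduct.map_comp,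
          LinearMap.lTensor_comp_rTensor]
    _ = z := by rw [h1, h2]

lemma finiteDimensional_span_leftSlice (z : A ⊗[k] A) :
    FiniteDimensional k (Submodule.span k (Set.range fun p : Module.Dual k A => leftSlice p z)) := by
  classical
  obtain ⟨S, rfl⟩ := TensorProduct.exists_finset z
  refine Submodule.finiteDimensional_of_le
    (S₂ := Submodule.span k ((S.image Prod.snd : Finset A) : Set A)) (Submodule.span_le.2 ?_)
  rintro _ ⟨p, rfl⟩
  simp only [map_sum, leftSlice_tmul, SetLike.mem_coe]
  exact Submodule.sum_mem _ fun i hi => Submodule.smul_mem _ _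
    (Submodule.subset_span (Finset.mem_image_of_mem _ hi))

end Slices

section Coalgebras

variable {k} {A : Type*} [AddCommGroup A] [Module k A] [Coalgebra k A]

/-- The operator `a ↦ Σ p(a₁) a₂`. -/
def leftHit (p : Module.Dual k A) : A →ₗ[k] A := leftSlice p ∘ₗ Coalgebra.comul

/-- The operator `a ↦ Σ a₁ p(a₂)`. -/
def rightHit (p : Module.Dual k A) : A →ₗ[k] A := rightSlice p ∘ₗ Coalgebra.comul

lemma rightSlice_counit_comul (a : A) :
    rightSlice Coalgebra.counit (Coalgebra.comul (R := k) a) = a := by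
  simp [rightSlice, Coalgebra.lTensor_counit_comul]

lemma leftSlice_counit_comul (a : A) :
    leftSlice Coalgebra.counit (Coalgebra.comul (R := k) a) = a := by
  simp [leftSlice, Coalgebra.rTensor_counit_comul]

lemma leftHit_rightHit (p q : Module.Dual k A) (a : A) :
    leftHit p (rightHit q a) = rightHit q (leftHit p a) := by
  have h1 (z : A ⊗[k] A) : Coalgebra.comul (R := k) (rightSlice q z) =
      (TensorProduct.rid k _).toLinearMap
        (TensorProduct.map LinearMap.id q (Coalgebra.comul.rTensor A z)) := by
    induction z with
    | zero => simp
    | tmul a b => simp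
    | add y z hy hz => simp [hy, hz]
  have h2 (z : A ⊗[k] A) : Coalgebra.comul (R := k) (leftSlice p z) =
      (TensorProduct.lid k _).toLinearMap
        (TensorProduct.map p LinearMap.id (Coalgebra.comul.lTensor A z)) := by
    induction z with
    | zero => simp
    | tmul a b => simp
    | add y z hy hz => simp [hy, hz]
  have h3 (w : (A ⊗[k] A) ⊗[k] A) :
      leftSlice p ((TensorProduct.rid k _).toLinearMap (TensorProduct.map LinearMap.id q w)) =
      rightSlice q ((TensorProduct.lid k _).toLinearMap
        (TensorProduct.map p LinearMap.id (TensorProduct.assoc k A A A w))) := by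
    induction w with
    | zero => simp
    | tmul z c =>
      induction z with
      | zero => simp
      | tmul a b => simpa using smul_comm (q c) (p a) b
      | add y z hy hz => simp only [TensorProduct.add_tmul, map_add, hy, hz]
    | add y z hy hz => simp only [map_add, hy, hz]
  simp only [leftHit, rightHit, LinearMap.comp_apply]
  rw [h1, h2, h3, Coalgebra.coassoc_apply]

/-- In a finite-dimensional pointed coalgebra every nonzero subcoalgebra contains a grouplike. -/
lemma exists_grouplike_mem_subcoalgebra [FiniteDimensional k A]
    (hA : IsPointedOf k (Coalgebra.comul (R := k) (A := A)))
    {C : Submodule k A} (hC : IsSubcoalgebraOf k (Coalgebra.comul (R := k)) C) (hC0 : C ≠ ⊥) :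
    ∃ h ∈ C, Coalgebra.counit (R := k) h = 1 ∧ Coalgebra.comul (R := k) h = h ⊗ₜ[k] h := by
  obtain ⟨D, ⟨hD, hD0, hDC⟩, hmin⟩ := (measure fun D : Submodule k A => Module.finrank k D).wf.has_min
    {D | IsSubcoalgebraOf k (Coalgebra.comul (R := k)) D ∧ D ≠ ⊥ ∧ D ≤ C} ⟨C, hC, hC0, le_rfl⟩
  have hsimple : IsSimpleSubcoalgebraOf k (Coalgebra.comul (R := k)) D := by
    refine ⟨hD0, hD, fun D' hD' hle => or_iff_not_imp_left.2 fun h0 => ?_⟩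
    exact Submodule.eq_of_le_of_finrank_le hle (not_lt.1 (hmin D' ⟨hD', h0, hle.trans hDC⟩))
  obtain ⟨⟨d, hdD⟩, hd0, hd⟩ := finrank_eq_one_iff'.1 (hA D hsimple)
  obtain ⟨z, hz⟩ := hD d hdD
  have hmem (z : D ⊗[k] D) : ∃ c : k, TensorProduct.map D.subtype D.subtype z = c • d ⊗ₜ[k] d := by
    induction z with
    | zero => exact ⟨0, by simp⟩
    | tmul a b =>
      obtain ⟨c, rfl⟩ := hd a
      obtain ⟨c', rfl⟩ := hd b
      exact ⟨c * c', TensorProduct.smul_tmul_smul c c' d d⟩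
    | add y z hy hz =>
      obtain ⟨c, hc⟩ := hy
      obtain ⟨c', hc'⟩ := hz
      exact ⟨c + c', by rw [map_add, hc, hc', add_smul]⟩
  obtain ⟨c, hc⟩ := hmem z
  rw [hz] at hc
  have hd0' : d ≠ 0 := fun h => hd0 (by simpa using h)
  have h1 := leftSlice_counit_comul (k := k) d
  rw [hc, map_smul, leftSlice_tmul, smul_smul] at h1
  have h2 : c * Coalgebra.counit (R := k) d = 1 :=
    smul_left_injective k hd0' (by simpa using h1)
  refine ⟨c • d, C.smul_mem _ (hDC hdD), by rw [map_smul, smul_eq_mul, h2], ?_⟩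
  rw [map_smul, hc, TensorProduct.smul_tmul', TensorProduct.tmul_smul]

/-- In a finite-dimensional pointed coalgebra every nonzero left coideal contains a grouplike. -/
lemma exists_grouplike_mem_coideal [FiniteDimensional k A]
    (hA : IsPointedOf k (Coalgebra.comul (R := k) (A := A)))
    {W : Submodule k A} (hW : ∀ p : Module.Dual k A, ∀ a ∈ W, leftHit p a ∈ W) (hW0 : W ≠ ⊥) :
    ∃ h ∈ W, Coalgebra.counit (R := k) h = 1 ∧ Coalgebra.comul (R := k) h = h ⊗ₜ[k] h := by
  let E : Subalgebra k (Module.End k A) := Algebra.adjoin k (Set.range leftHit)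
  have hgen (p : Module.Dual k A) : leftHit p ∈ E := Algebra.subset_adjoin ⟨p, rfl⟩
  have stable {U : Submodule k A} (hU : ∀ p : Module.Dual k A, ∀ a ∈ U, leftHit p a ∈ U)
      (e : E) : ∀ a ∈ U, e • a ∈ U := by
    obtain ⟨e, he⟩ := e
    change ∀ a ∈ U, e a ∈ U
    induction he using Algebra.adjoin_induction with
    | mem x hx => obtain ⟨p, rfl⟩ := hx; exact hU p
    | algebraMap r => intro a ha; exact U.smul_mem r ha
    | add x y _ _ hx hy => exact fun a ha => U.add_mem (hx a ha) (hy a ha)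
    | mul x y _ _ hx hy => exact fun a ha => hx _ (hy a ha)
  let WE : Submodule E A := { W with smul_mem' := fun e a ha => stable hW e a ha }
  have : IsArtinian E A := isArtinian_of_tower k inferInstance
  have hWE : WE ≠ ⊥ := fun h => hW0 (by
    rw [Submodule.eq_bot_iff] at h ⊢
    exact h)
  obtain ⟨N, hN, hNW⟩ := (eq_bot_or_exists_atom_le WE).resolve_left hWE
  have : IsSimpleModule E N := isSimpleModule_iff_isAtom.2 hN
  let I := isotypicComponent E A N
  have hright (q : Module.Dual k A) (a : A) (ha : a ∈ I) : rightHit q a ∈ I := by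
    let f : Module.End E A :=
      { toFun := rightHit q
        map_add' := map_add _
        map_smul' := by
          rintro ⟨e, he⟩ a
          change rightHit q (e a) = e (rightHit q a)
          induction he using Algebra.adjoin_induction generalizing a with
          | mem x hx => obtain ⟨p, rfl⟩ := hx; exact (leftHit_rightHit p q a).symm
          | algebraMap r => simp [Module.algebraMap_end_apply]
          | add x y _ _ hx hy => simp [hx, hy]
          | mul x y _ _ hx hy => simp [hx, hy] }
    exact Submodule.IsFullyInvariant.isotypicComponent E A N f ha
  obtain ⟨h, hhI, hε, hΔ⟩ := exists_grouplike_mem_subcoalgebra hA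
    (C := I.restrictScalars k)
    (fun a ha => mem_range_map_subtype (fun p => I.smul_mem ⟨_, hgen p⟩ ha) fun p => hright p a ha)
    (fun h0 => (bot_lt_isotypicComponent N).ne' ((Submodule.restrictScalars_eq_bot_iff _ _ _).1 h0))
  have hleft (p : Module.Dual k A) : leftHit p h = p h • h := by simp [leftHit, hΔ]
  have hspan (e : E) : ∀ a ∈ Submodule.span k {h}, e • a ∈ Submodule.span k {h} := by
    refine stable (fun p a ha => ?_) e
    obtain ⟨c, rfl⟩ := Submodule.mem_span_singleton.1 ha
    rw [map_smul, hleft]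
    exact Submodule.smul_mem _ _ (Submodule.smul_mem _ _ (Submodule.mem_span_singleton_self h))
  let H : Submodule E A := { Submodule.span k {h} with smul_mem' := fun e a ha => hspan e a ha }
  have hhH : h ∈ H := Submodule.mem_span_singleton_self h
  have h0 : h ≠ 0 := by rintro rfl; simp at hε
  have hHI : H ≤ I := by
    intro a ha
    obtain ⟨c, rfl⟩ := Submodule.mem_span_singleton.1 (show a ∈ Submodule.span k {h} from ha)
    exact (I.restrictScalars k).smul_mem c hhI
  have : IsSimpleModule E H := by
    rw [isSimpleModule_iff_isAtom]
    refine ⟨fun hb => h0 ?_, fun H' hlt => ?_⟩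
    · rw [hb] at hhH
      simpa using hhH
    · rw [Submodule.eq_bot_iff]
      intro a ha
      by_contra ha0
      obtain ⟨c, rfl⟩ := Submodule.mem_span_singleton.1
        (show a ∈ Submodule.span k {h} from hlt.le ha)
      have hc : c ≠ 0 := by rintro rfl; simp at ha0
      have hh' : h ∈ H' := by
        simpa [smul_smul, hc] using (H'.restrictScalars k).smul_mem c⁻¹ ha
      refine hlt.not_ge fun b hb => ?_
      obtain ⟨c, rfl⟩ := Submodule.mem_span_singleton.1
        (show b ∈ Submodule.span k {h} from hb)
      exact (H'.restrictScalars k).smul_mem c hh'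
  obtain ⟨e⟩ := isIsotypicOfType_submodule_iff.1
    (IsIsotypicOfType.isotypicComponent E A N) H hHI
  let n := e ⟨h, hhH⟩
  have hn0 : (n : A) ≠ 0 := fun hn => h0 (by
    exact congrArg Subtype.val (e.map_eq_zero_iff.1 (Subtype.ext hn : e ⟨h, hhH⟩ = 0)))
  have hn (p : Module.Dual k A) : leftHit p (n : A) = p h • (n : A) := by
    have h1 : (⟨_, hgen p⟩ : E) • (⟨h, hhH⟩ : H) =
        (algebraMap k E (p h)) • (⟨h, hhH⟩ : H) := Subtype.ext (hleft p)
    have h2 := congrArg (fun y => ((e y : N) : A)) h1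
    rw [e.map_smul, e.map_smul] at h2
    exact h2
  have hΔn : Coalgebra.comul (R := k) (n : A) = h ⊗ₜ[k] (n : A) :=
    ext_leftSlice fun p => (hn p).trans (leftSlice_tmul p h _).symm
  have hnh := rightSlice_counit_comul (k := k) (n : A)
  rw [hΔn, rightSlice_tmul] at hnh
  have hc : Coalgebra.counit (R := k) (n : A) ≠ 0 := fun hc => hn0 (by rw [← hnh, hc, zero_smul])
  refine ⟨h, ?_, hε, hΔ⟩
  have hnW : (n : A) ∈ W := hNW n.2
  rw [← hnh] at hnW
  exact (W.smul_mem_iff hc).1 hnW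

end Coalgebras

section SkewPrimitives

variable {k} {A : Type*} [Ring A] [HopfAlgebra k A]

lemma mem_skewPrimitives_iff {g h x : A} :
    x ∈ skewPrimitives k A g h ↔ IsSkewPrimitive k A g h x := by
  simp [skewPrimitives, IsSkewPrimitive, sub_eq_zero]

lemma IsGrouplike.mul_antipode {g : A} (hg : IsGrouplike k A g) :
    g * HopfAlgebra.antipode k g = 1 := by
  simpa [hg.1, hg.2] using HopfAlgebra.mul_antipode_lTensor_comul_apply (R := k) g

lemma IsGrouplike.antipode_mul {g : A} (hg : IsGrouplike k A g) :
    HopfAlgebra.antipode k g * g = 1 := by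
  simpa [hg.1, hg.2] using HopfAlgebra.mul_antipode_rTensor_comul_apply (R := k) g

lemma IsGrouplike.isUnit {g : A} (hg : IsGrouplike k A g) : IsUnit g :=
  ⟨⟨g, _, hg.mul_antipode, hg.antipode_mul⟩, rfl⟩

lemma IsGrouplike.pow {g : A} (hg : IsGrouplike k A g) (n : ℕ) : IsGrouplike k A (g ^ n) := by
  induction n with
  | zero => exact ⟨by simp, by simp [Algebra.TensorProduct.one_def]⟩
  | succ n ih =>
    exact ⟨by simp [pow_succ, hg.1, ih.1], by
      rw [pow_succ, Bialgebra.comul_mul, hg.2, ih.2, Algebra.TensorProduct.tmul_mul_tmul]⟩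

lemma IsGrouplike.exists_pow_eq_one [FiniteDimensional k A] {g : A} (hg : IsGrouplike k A g) :
    ∃ n : ℕ, 0 < n ∧ g ^ n = 1 := by
  have hfin : {a : A | IsGroupLikeElem k a}.Finite :=
    linearIndepOn_isGroupLikeElem.linearIndependent.setFinite
  have hmem : ∀ n : ℕ, g ^ n ∈ {a : A | IsGroupLikeElem k a} := fun n =>
    ⟨(hg.pow n).1, (hg.pow n).2⟩
  obtain ⟨m, -, n, -, hmn, h⟩ :=
    Set.infinite_univ.exists_ne_map_eq_of_mapsTo (fun n _ => hmem n) hfin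
  wlog hlt : m < n generalizing m n
  · exact this n m hmn.symm h.symm (lt_of_le_of_ne (not_lt.1 hlt) hmn.symm)
  refine ⟨n - m, Nat.sub_pos_of_lt hlt, ?_⟩
  have : g ^ m * g ^ (n - m) = g ^ m * 1 := by
    rw [← pow_add, Nat.add_sub_cancel' hlt.le, mul_one]; exact h.symm
  exact (hg.pow m).isUnit.mul_left_cancel this

/-- In characteristic zero, a skew primitive `x ∈ P_{1,g}` which commutes with `g` and is
integral over the base field is trivial. -/
lemma mem_span_one_sub_of_commute [CharZero k] {g x : A} (hg : IsGrouplike k A g)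
    (hx : Coalgebra.comul (R := k) x = x ⊗ₜ[k] 1 + g ⊗ₜ[k] x) (hgx : Commute g x)
    (hint : IsIntegral k x) : x ∈ Submodule.span k {(1 : A) - g} := by
  classical
  have : Nontrivial A := ⟨1, 0, fun h => by
    simpa using congrArg (Coalgebra.counit (R := k)) h⟩
  let U (m : ℕ) : Submodule k A := Submodule.span k ((x ^ ·) '' Set.Iio m)
  have hex : ∃ m, x ^ m ∈ U m := by
    refine ⟨(minpoly k x).natDegree, ?_⟩
    have h := minpoly.aeval k x
    rw [(minpoly.monic hint).as_sum] at h
    simp only [map_add, map_pow, Polynomial.aeval_X, map_sum, map_mul, Polynomial.aeval_C] at h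
    rw [eq_neg_of_add_eq_zero_left h]
    refine Submodule.neg_mem _ (Submodule.sum_mem _ fun i hi => ?_)
    rw [← Algebra.smul_def]
    exact Submodule.smul_mem _ _ (Submodule.subset_span ⟨i, Finset.mem_range.1 hi, rfl⟩)
  obtain ⟨hm, hmin⟩ := Nat.find_spec hex, fun n => Nat.find_min hex (m := n)
  generalize Nat.find hex = m at hm hmin
  obtain _ | m := m
  · simp [U] at hm
  obtain ⟨f, hfx, hf⟩ := Submodule.exists_le_ker_of_notMem (hmin m (Nat.lt_succ_self m))
  have hf' (i : ℕ) (hi : i < m) : f (x ^ i) = 0 := hf (Submodule.subset_span ⟨i, hi, rfl⟩)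
  have hcomm : Commute (g ⊗ₜ[k] x) (x ⊗ₜ[k] (1 : A)) := by
    simp [Commute, SemiconjBy, hgx.eq]
  have hD (j : ℕ) : rightHit f (x ^ j) =
      ∑ i ∈ Finset.range (j + 1), ((j.choose i : k) * f (x ^ i)) • (g ^ i * x ^ (j - i)) := by
    have : Coalgebra.comul (R := k) (x ^ j) = (g ⊗ₜ[k] x + x ⊗ₜ[k] (1 : A)) ^ j := by
      rw [← Bialgebra.comulAlgHom_apply, map_pow, Bialgebra.comulAlgHom_apply, hx, add_comm]
    rw [rightHit, LinearMap.comp_apply, this, hcomm.add_pow, map_sum]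
    refine Finset.sum_congr rfl fun i _ => ?_
    rw [← nsmul_eq_mul', map_nsmul]
    simp [Algebra.TensorProduct.tmul_pow, mul_smul, Nat.cast_smul_eq_nsmul]
  have hU (a : A) (ha : a ∈ U (m + 1)) : rightHit f a = f a • g ^ m := by
    have : U (m + 1) ≤ LinearMap.eqLocus (rightHit f) (f.smulRight (g ^ m)) := by
      refine Submodule.span_le.2 ?_
      rintro _ ⟨j, hj, rfl⟩
      change rightHit f (x ^ j) = f (x ^ j) • g ^ m
      rw [hD, Finset.sum_range_succ, Finset.sum_eq_zero]
      · rcases (Nat.lt_succ_iff.1 hj).lt_or_eq with h | rfl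
        · simp [hf' _ h]
        · simp
      · intro i hi
        rw [hf' i (lt_of_lt_of_le (Finset.mem_range.1 hi) (Nat.lt_succ_iff.1 hj)), mul_zero,
          zero_smul]
    exact this ha
  have key := hU _ hm
  rw [hD, Finset.sum_range_succ, Finset.sum_range_succ, Finset.sum_eq_zero (fun i hi => by
    rw [hf' i (Finset.mem_range.1 hi), mul_zero, zero_smul])] at key
  simp only [Nat.choose_succ_self_right, Nat.choose_self, zero_add, Nat.add_sub_cancel_left,
    pow_one, Nat.sub_self, pow_zero, mul_one, Nat.cast_one, one_mul] at key
  have hc : ((m + 1 : ℕ) : k) * f (x ^ m) ≠ 0 := mul_ne_zero (by exact_mod_cast m.succ_ne_zero) hfx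
  have h2 : g ^ m * ((((m + 1 : ℕ) : k) * f (x ^ m)) • x) = g ^ m * (f (x ^ (m + 1)) • (1 - g)) := by
    rw [mul_smul_comm, mul_smul_comm, mul_sub, mul_one, ← pow_succ, smul_sub, ← key,
      add_sub_cancel_right]
  have h3 := (hg.pow m).isUnit.mul_left_cancel h2
  rw [← Submodule.smul_mem_iff _ hc, h3]
  exact Submodule.smul_mem _ _ (Submodule.mem_span_singleton_self _)

end SkewPrimitives

section RMatrix

variable {k} {A : Type*} [Ring A] [HopfAlgebra k A]

lemma leftSlice_mul_leftSlice {r : A ⊗[k] A} (hr : Hexagon₁ k A r) (p q : Module.Dual k A) :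
    leftSlice p r * leftSlice q r =
      leftSlice (LinearMap.mul' k k ∘ₗ TensorProduct.map p q ∘ₗ Coalgebra.comul) r := by
  let Φ : (A ⊗[k] A) ⊗[k] A →ₗ[k] A := (TensorProduct.lid k A).toLinearMap ∘ₗ
    (LinearMap.mul' k k ∘ₗ TensorProduct.map p q).rTensor A
  have h1 (z w : A ⊗[k] A) :
      Φ (Algebra.TensorProduct.map (Algebra.TensorProduct.includeLeft (R := k) (S := k))
          (AlgHom.id k A) z *
        Algebra.TensorProduct.map (Algebra.TensorProduct.includeRight (R := k))
          (AlgHom.id k A) w) = leftSlice p z * leftSlice q w := by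
    induction z with
    | zero => simp
    | tmul a b =>
      induction w with
      | zero => simp
      | tmul c d => simp [Φ, smul_smul, mul_comm]
      | add y z hy hz => simp only [map_add, mul_add, hy, hz]
    | add y z hy hz => simp only [map_add, add_mul, hy, hz]
  have h2 (z : A ⊗[k] A) :
      Φ (Algebra.TensorProduct.map (Bialgebra.comulAlgHom k A) (AlgHom.id k A) z) =
      leftSlice (LinearMap.mul' k k ∘ₗ TensorProduct.map p q ∘ₗ Coalgebra.comul) z := by
    induction z with
    | zero => simp
    | tmul a b => simp [Φ]
    | add y z hy hz => simp only [map_add, hy, hz]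
  rw [← h1, ← h2, hr]

lemma rTensor_rightHit {r : A ⊗[k] A} (hr : Hexagon₁ k A r) (q : Module.Dual k A) :
    (rightHit q).rTensor A r = r * (1 ⊗ₜ[k] leftSlice q r) := by
  have h1 (z w : A ⊗[k] A) :
      (rightSlice q).rTensor A
        (Algebra.TensorProduct.map (Algebra.TensorProduct.includeLeft (R := k) (S := k))
          (AlgHom.id k A) z *
        Algebra.TensorProduct.map (Algebra.TensorProduct.includeRight (R := k))
          (AlgHom.id k A) w) = z * (1 ⊗ₜ[k] leftSlice q w) := by
    induction z with
    | zero => simp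
    | tmul a b =>
      induction w with
      | zero => simp
      | tmul c d => simp [TensorProduct.smul_tmul']
      | add y z hy hz => simp only [map_add, mul_add, TensorProduct.tmul_add, hy, hz]
    | add y z hy hz => simp only [map_add, add_mul, hy, hz]
  have h2 (z : A ⊗[k] A) :
      (rightSlice q).rTensor A
        (Algebra.TensorProduct.map (Bialgebra.comulAlgHom k A) (AlgHom.id k A) z) =
      (rightHit q).rTensor A z := by
    induction z with
    | zero => simp
    | tmul a b => simp [rightHit]
    | add y z hy hz => simp only [map_add, hy, hz]
  rw [← h1, ← h2, hr]

lemma antipode_rTensor_mul_self {r : A ⊗[k] A} (hr : Hexagon₁ k A r) :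
    (HopfAlgebra.antipode k).rTensor A r * r = 1 ⊗ₜ[k] leftSlice Coalgebra.counit r := by
  let Θ : (A ⊗[k] A) ⊗[k] A →ₗ[k] A ⊗[k] A :=
    (LinearMap.mul' k A ∘ₗ (HopfAlgebra.antipode k).rTensor A).rTensor A
  have h1 (z w : A ⊗[k] A) :
      Θ (Algebra.TensorProduct.map (Algebra.TensorProduct.includeLeft (R := k) (S := k))
          (AlgHom.id k A) z *
        Algebra.TensorProduct.map (Algebra.TensorProduct.includeRight (R := k))
          (AlgHom.id k A) w) = (HopfAlgebra.antipode k).rTensor A z * w := by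
    induction z with
    | zero => simp
    | tmul a b =>
      induction w with
      | zero => simp
      | tmul c d => simp [Θ]
      | add y z hy hz => simp only [map_add, mul_add, hy, hz]
    | add y z hy hz => simp only [map_add, add_mul, hy, hz]
  have h2 (z : A ⊗[k] A) :
      Θ (Algebra.TensorProduct.map (Bialgebra.comulAlgHom k A) (AlgHom.id k A) z) =
      1 ⊗ₜ[k] leftSlice Coalgebra.counit z := by
    induction z with
    | zero => simp
    | tmul a b => simp [Θ, Algebra.algebraMap_eq_smul_one, TensorProduct.smul_tmul]
    | add y z hy hz => simp only [map_add, TensorProduct.tmul_add, hy, hz]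
  rw [← h1, ← h2, hr]

lemma rightSlice_comul_leftSlice {r : A ⊗[k] A} (hr : Hexagon₂ k A r) (p q : Module.Dual k A) :
    rightSlice q (Coalgebra.comul (R := k) (leftSlice p r)) =
      leftSlice (p ∘ₗ LinearMap.mulLeft k (rightSlice q r)) r := by
  let Ξ : A ⊗[k] (A ⊗[k] A) →ₗ[k] A := (TensorProduct.lid k A).toLinearMap ∘ₗ
    TensorProduct.map p (rightSlice q)
  have h1 (z w : A ⊗[k] A) :
      Ξ (Algebra.TensorProduct.map (AlgHom.id k A)
          (Algebra.TensorProduct.includeRight (R := k)) z *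
        Algebra.TensorProduct.map (AlgHom.id k A)
          (Algebra.TensorProduct.includeLeft (R := k) (S := k)) w) =
      leftSlice (p ∘ₗ LinearMap.mulLeft k (rightSlice q z)) w := by
    induction w with
    | zero => simp
    | tmul a b =>
      induction z with
      | zero => simp
      | tmul c d => simp [Ξ, smul_smul, mul_comm]
      | add y z hy hz =>
        simp only [map_add, add_mul, hy, hz, leftSlice_tmul, LinearMap.comp_apply,
          LinearMap.mulLeft_apply, add_smul]
    | add y z hy hz => simp only [map_add, mul_add, hy, hz]
  have h2 (z : A ⊗[k] A) :
      Ξ (Algebra.TensorProduct.map (AlgHom.id k A) (Bialgebra.comulAlgHom k A) z) =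
      rightSlice q (Coalgebra.comul (R := k) (leftSlice p z)) := by
    induction z with
    | zero => simp
    | tmul a b => simp [Ξ]
    | add y z hy hz => simp only [map_add, hy, hz]
  rw [← h1, ← h2, hr]

lemma leftSlice_comul_leftSlice {r : A ⊗[k] A} (hr : Hexagon₂ k A r) (p q : Module.Dual k A) :
    leftSlice q (Coalgebra.comul (R := k) (leftSlice p r)) =
      leftSlice (p ∘ₗ LinearMap.mulRight k (rightSlice q r)) r := by
  let Ξ : A ⊗[k] (A ⊗[k] A) →ₗ[k] A := (TensorProduct.lid k A).toLinearMap ∘ₗ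
    TensorProduct.map p (leftSlice q)
  have h1 (z w : A ⊗[k] A) :
      Ξ (Algebra.TensorProduct.map (AlgHom.id k A)
          (Algebra.TensorProduct.includeRight (R := k)) z *
        Algebra.TensorProduct.map (AlgHom.id k A)
          (Algebra.TensorProduct.includeLeft (R := k) (S := k)) w) =
      leftSlice (p ∘ₗ LinearMap.mulRight k (rightSlice q w)) z := by
    induction z with
    | zero => simp
    | tmul a b =>
      induction w with
      | zero => simp
      | tmul c d => simp [Ξ, smul_smul, mul_comm]
      | add y z hy hz =>
        simp only [map_add, mul_add, hy, hz, leftSlice_tmul, LinearMap.comp_apply,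
          LinearMap.mulRight_apply, add_smul]
    | add y z hy hz => simp only [map_add, add_mul, hy, hz]
  have h2 (z : A ⊗[k] A) :
      Ξ (Algebra.TensorProduct.map (AlgHom.id k A) (Bialgebra.comulAlgHom k A) z) =
      leftSlice q (Coalgebra.comul (R := k) (leftSlice p z)) := by
    induction z with
    | zero => simp
    | tmul a b => simp [Ξ]
    | add y z hy hz => simp only [map_add, hy, hz]
  rw [← h1, ← h2, hr]

lemma leftSlice_one (p : Module.Dual k A) : leftSlice p (1 : A ⊗[k] A) = p 1 • 1 := by
  rw [Algebra.TensorProduct.one_def, leftSlice_tmul]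

lemma leftSlice_mul (χ : A →ₐ[k] k) (z w : A ⊗[k] A) :
    leftSlice χ.toLinearMap (z * w) = leftSlice χ.toLinearMap z * leftSlice χ.toLinearMap w := by
  induction z with
  | zero => simp
  | tmul a b =>
    induction w with
    | zero => simp
    | tmul c d => simp [smul_smul, mul_comm]
    | add y z hy hz => simp only [map_add, mul_add, hy, hz]
  | add y z hy hz => simp only [map_add, add_mul, hy, hz]

namespace QuasiTriangular

variable (Q : QuasiTriangular k A)

lemma leftSlice_counit : leftSlice Coalgebra.counit Q.R = 1 := by
  have h1 := rTensor_rightHit Q.hexagon₁ Coalgebra.counit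
  have h2 : rightHit (Coalgebra.counit (R := k) (A := A)) = LinearMap.id :=
    LinearMap.ext rightSlice_counit_comul
  rw [h2, LinearMap.rTensor_id, LinearMap.id_apply] at h1
  have h3 := Q.isUnit.mul_left_cancel ((mul_one Q.R).trans h1)
  have h4 := congrArg (leftSlice Coalgebra.counit) h3
  simpa [leftSlice_one] using h4.symm

variable {Q}

lemma IsTriangular.antipode_rTensor (htri : Q.IsTriangular) :
    (HopfAlgebra.antipode k).rTensor A Q.R = TensorProduct.comm k A A Q.R := by
  have h := antipode_rTensor_mul_self Q.hexagon₁
  rw [Q.leftSlice_counit, ← Algebra.TensorProduct.one_def] at h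
  calc _ = (HopfAlgebra.antipode k).rTensor A Q.R * (Q.R * TensorProduct.comm k A A Q.R) := by
        rw [htri, mul_one]
    _ = _ := by rw [← mul_assoc, h, one_mul]

lemma IsTriangular.rightSlice_eq (htri : Q.IsTriangular) (p : Module.Dual k A) :
    rightSlice p Q.R = leftSlice (p ∘ₗ HopfAlgebra.antipode k) Q.R := by
  rw [← leftSlice_comm, ← htri.antipode_rTensor, leftSlice_rTensor]

lemma IsTriangular.leftSlice_eq_antipode (htri : Q.IsTriangular) (p : Module.Dual k A) :
    leftSlice p Q.R =
      HopfAlgebra.antipode k (leftSlice (p ∘ₗ HopfAlgebra.antipode k) Q.R) := by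
  have (z : A ⊗[k] A) : leftSlice p z = rightSlice p (TensorProduct.comm k A A z) := by
    rw [← leftSlice_comm]
    congr 1
    exact ((TensorProduct.comm k A A).symm_apply_apply z).symm
  rw [this, ← htri.antipode_rTensor, rightSlice_rTensor, htri.rightSlice_eq]

variable (Q) in
/-- The map `p ↦ (p ⊗ id)(R)` from the dual of `A` to `A`. -/
def sliceMap : Module.Dual k A →ₗ[k] A where
  toFun p := leftSlice p Q.R
  map_add' p q := by simp [leftSlice, LinearMap.rTensor_add]
  map_smul' c p := by simp [leftSlice, LinearMap.rTensor_smul]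

/-- For a minimal triangular Hopf algebra the left slices of `R` exhaust `A`. -/
lemma sliceMap_surjective (htri : Q.IsTriangular) (hmin : Q.IsMinimal) :
    Function.Surjective Q.sliceMap := by
  let H := LinearMap.range Q.sliceMap
  have hH (p : Module.Dual k A) : leftSlice p Q.R ∈ H := ⟨p, rfl⟩
  let B : Subalgebra k A := H.toSubalgebra ⟨Coalgebra.counit, Q.leftSlice_counit⟩ (by
    rintro _ _ ⟨p, rfl⟩ ⟨q, rfl⟩
    exact ⟨_, (leftSlice_mul_leftSlice Q.hexagon₁ p q).symm⟩)
  have hfd : FiniteDimensional k H :=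
    have := finiteDimensional_span_leftSlice Q.R
    Submodule.finiteDimensional_of_le (S₂ := Submodule.span k (Set.range fun p => leftSlice p Q.R))
      (by rintro _ ⟨p, rfl⟩; exact Submodule.subset_span ⟨p, rfl⟩)
  have hS : H.map (HopfAlgebra.antipode k) = H := by
    refine (Submodule.eq_of_le_of_finrank_le ?_ (Submodule.finrank_map_le _ _)).symm
    rintro _ ⟨p, rfl⟩
    exact ⟨_, hH _, (htri.leftSlice_eq_antipode p).symm⟩
  have hB : B = ⊤ := by
    refine hmin B ⟨?_, fun x hx => ?_⟩ ?_
    · rintro _ ⟨p, rfl⟩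
      refine mem_range_map_subtype (C := H) (fun q => ?_) fun q => ?_
      · exact ⟨_, (leftSlice_comul_leftSlice Q.hexagon₂ p q).symm⟩
      · exact ⟨_, (rightSlice_comul_leftSlice Q.hexagon₂ p q).symm⟩
    · exact hS.le (Submodule.mem_map_of_mem hx)
    · exact mem_range_map_subtype (C := H) hH fun p => htri.rightSlice_eq p ▸ hH _
  intro a
  have : a ∈ B := hB ▸ Algebra.mem_top
  exact this

lemma finiteDimensional (htri : Q.IsTriangular) (hmin : Q.IsMinimal) : FiniteDimensional k A := by
  have h := finiteDimensional_span_leftSlice Q.R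
  have : Submodule.span k (Set.range fun p : Module.Dual k A => leftSlice p Q.R) = ⊤ :=
    Submodule.eq_top_iff'.2 fun a =>
      Submodule.subset_span (sliceMap_surjective htri hmin a)
  rw [this] at h
  exact Module.finite_def.2 (Module.Finite.iff_fg.1 h)

/-- Characters attached to grouplikes pair to inverse scalars. -/
lemma IsTriangular.character_mul_character (htri : Q.IsTriangular) {g h : A} {χ η : A →ₐ[k] k}
    (hχ : leftSlice χ.toLinearMap Q.R = g) (hη : leftSlice η.toLinearMap Q.R = h) :
    η g * χ h = 1 := by
  have h1 := congrArg (fun z => η (leftSlice χ.toLinearMap z)) htri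
  simp only [leftSlice_mul, leftSlice_comm, leftSlice_one, map_mul, hχ] at h1
  have h2 := apply_leftSlice η.toLinearMap χ.toLinearMap Q.R
  rw [hη] at h2
  simp only [AlgHom.toLinearMap_apply] at h2
  rw [h2, h1]
  simp

/-- Conjugation of a skew primitive by the grouplike attached to a character. -/
lemma mul_slice_skewPrimitive {g x h : A} (hx : x ∈ skewPrimitives k A 1 g) {χ : A →ₐ[k] k}
    (hχ : leftSlice χ.toLinearMap Q.R = h) :
    (x + χ x • g) * h = h * (χ x • 1 + χ g • x) := by
  have hΔ : Coalgebra.comul x = x ⊗ₜ[k] 1 + g ⊗ₜ[k] x := mem_skewPrimitives_iff.1 hx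
  have h1 := congrArg (leftSlice χ.toLinearMap) (Q.intertwine x)
  simpa [leftSlice_mul, hχ, hΔ, add_comm] using h1

variable [FiniteDimensional k A]

lemma sliceMap_injective (htri : Q.IsTriangular) (hmin : Q.IsMinimal) :
    Function.Injective Q.sliceMap :=
  (LinearMap.injective_iff_surjective_of_finrank_eq_finrank Subspace.dual_finrank_eq).2
    (sliceMap_surjective htri hmin)

lemma rightSlice_surjective (htri : Q.IsTriangular) (hmin : Q.IsMinimal) (a : A) :
    ∃ p : Module.Dual k A, rightSlice p Q.R = a := by
  obtain ⟨q, hq⟩ := sliceMap_surjective htri hmin (HopfAlgebra.antipode k a)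
  let F : Module.Dual k A →ₗ[k] A :=
    { toFun := fun p => rightSlice p Q.R
      map_add' := fun p q => by simp [rightSlice, LinearMap.lTensor_add]
      map_smul' := fun c p => by simp [rightSlice, LinearMap.lTensor_smul] }
  have hF : Function.Injective F := by
    refine (injective_iff_map_eq_zero F).2 fun p hp => LinearMap.ext fun a => ?_
    obtain ⟨q, rfl⟩ := sliceMap_surjective htri hmin a
    change p (leftSlice q Q.R) = 0
    rw [apply_leftSlice, show rightSlice p Q.R = 0 from hp, map_zero]
  exact (LinearMap.injective_iff_surjective_of_finrank_eq_finrank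
    Subspace.dual_finrank_eq).1 hF a

/-- A grouplike element of a minimal triangular Hopf algebra is the slice of `R` along a
character. -/
lemma exists_character (htri : Q.IsTriangular) (hmin : Q.IsMinimal) {g : A}
    (hg : IsGrouplike k A g) : ∃ χ : A →ₐ[k] k, leftSlice χ.toLinearMap Q.R = g := by
  obtain ⟨χ, hχ⟩ := sliceMap_surjective htri hmin g
  replace hχ : leftSlice χ Q.R = g := hχ
  have hmul (a b : A) : χ (a * b) = χ a * χ b := by
    obtain ⟨p, rfl⟩ := rightSlice_surjective htri hmin a
    obtain ⟨q, rfl⟩ := rightSlice_surjective htri hmin b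
    rw [← apply_leftSlice χ p, ← apply_leftSlice χ q, hχ]
    calc _ = q (leftSlice (χ ∘ₗ LinearMap.mulLeft k (rightSlice p Q.R)) Q.R) := by
          rw [apply_leftSlice]; rfl
      _ = _ := by
          rw [← rightSlice_comul_leftSlice Q.hexagon₂, hχ, hg.2]
          simp
  have hne : χ ≠ 0 := by
    rintro rfl
    have h0 : g = 0 := by rw [← hχ]; exact Q.sliceMap.map_zero
    simpa [h0] using hg.1
  obtain ⟨a, ha⟩ : ∃ a, χ a ≠ 0 := by
    by_contra! h
    exact hne (LinearMap.ext h)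
  have h1 : χ 1 = 1 := mul_left_cancel₀ ha (by rw [← hmul, mul_one, mul_one])
  exact ⟨AlgHom.ofLinearMap χ h1 hmul, hχ⟩

/-- If the character of `g` is quadratic on all grouplikes of a pointed minimal triangular
Hopf algebra, then `g² = 1`. -/
lemma sq_eq_one_of_character [CharZero k] (htri : Q.IsTriangular) (hmin : Q.IsMinimal)
    (hpointed : IsPointed k A) {g : A} (hg : IsGrouplike k A g) {χ : A →ₐ[k] k}
    (hχ : leftSlice χ.toLinearMap Q.R = g)
    (hsq : ∀ h : A, IsGrouplike k A h → χ h ^ 2 = 1) : g ^ 2 = 1 := by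
  let T : Module.End k A := rightHit χ.toLinearMap
  have hT (n : ℕ) : (T ^ n).rTensor A Q.R = Q.R * (1 ⊗ₜ[k] (g ^ n)) := by
    induction n with
    | zero => simp [Module.End.one_eq_id, ← Algebra.TensorProduct.one_def]
    | succ n ih =>
      have hmul (z : A ⊗[k] A) (b : A) :
          T.rTensor A (z * (1 ⊗ₜ[k] b)) = T.rTensor A z * (1 ⊗ₜ[k] b) := by
        induction z with
        | zero => simp
        | tmul a c => simp
        | add y z hy hz => simp only [map_add, add_mul, hy, hz]
      rw [pow_succ', Module.End.mul_eq_comp, LinearMap.rTensor_comp_apply, ih, hmul,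
        rTensor_rightHit Q.hexagon₁, hχ, mul_assoc, Algebra.TensorProduct.tmul_mul_tmul, one_mul,
        ← pow_succ']
  have hT_one {n : ℕ} (hn : g ^ n = 1) : T ^ n = 1 := by
    have h := hT n
    rw [hn, ← Algebra.TensorProduct.one_def, mul_one] at h
    refine LinearMap.ext fun a => sub_eq_zero.1
      ((Module.forall_dual_apply_eq_zero_iff k _).1 fun p => ?_)
    have hp : Q.sliceMap (p ∘ₗ T ^ n) = Q.sliceMap p := by
      change leftSlice _ Q.R = leftSlice _ Q.R
      rw [← leftSlice_rTensor, h]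
    have := LinearMap.congr_fun (sliceMap_injective htri hmin hp) a
    rw [map_sub, sub_eq_zero]
    exact this
  obtain ⟨n, hn0, hn⟩ := hg.exists_pow_eq_one
  let s : Module.End k A := ∑ i ∈ Finset.range n, (T ^ 2) ^ i
  have hcomm (p : Module.Dual k A) : Commute s (leftHit p) :=
    Commute.sum_left _ _ _ fun i _ => Commute.pow_left (Commute.pow_left
      (LinearMap.ext fun a => (leftHit_rightHit p _ a).symm) 2) i
  have hker : LinearMap.ker s = ⊥ := by
    by_contra hne
    obtain ⟨h, hs, hh⟩ := exists_grouplike_mem_coideal hpointed (W := LinearMap.ker s)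
      (fun p a ha => by
        have := LinearMap.congr_fun (hcomm p).eq a
        rw [Module.End.mul_apply, Module.End.mul_apply, LinearMap.mem_ker.1 ha, map_zero] at this
        exact this) hne
    have hTh : T h = χ h • h := by simp [T, rightHit, hh.2]
    have hT2 : (T ^ 2) h = h := by
      rw [pow_two, Module.End.mul_apply, hTh, map_smul, hTh, smul_smul, ← pow_two, hsq h hh,
        one_smul]
    have hTi (i : ℕ) : ((T ^ 2) ^ i) h = h := by
      rw [Module.End.pow_apply]
      exact Function.iterate_fixed hT2 i
    have h0 : h ≠ 0 := by rintro rfl; simpa using hh.1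
    have hs' : n • h = 0 := by simpa [s, hTi] using hs
    rw [← Nat.cast_smul_eq_nsmul k, smul_eq_zero, Nat.cast_eq_zero] at hs'
    exact hs'.elim hn0.ne' h0
  have hs1 : s * (T ^ 2 - 1) = 0 := by
    rw [geom_sum_mul, ← pow_mul, mul_comm, pow_mul, hT_one hn, one_pow, sub_self]
  have hT2 : T ^ 2 = 1 := LinearMap.ext fun a => sub_eq_zero.1
    (LinearMap.ker_eq_bot'.1 hker _ (LinearMap.congr_fun hs1 a))
  have h := hT 2
  rw [hT2, Module.End.one_eq_id, LinearMap.rTensor_id, LinearMap.id_apply] at h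
  have h1 := congrArg (leftSlice Coalgebra.counit)
    (Q.isUnit.mul_left_cancel ((mul_one Q.R).trans h))
  simpa [leftSlice_one] using h1.symm

end QuasiTriangular

end RMatrix

/-- Let `(A,R)` be a minimal triangular pointed Hopf algebra over an
algebraically closed field `k` of characteristic `0`, `G = G(A)`, and for `g ∈ G` let
`V_g` be a `⟨g⟩`-stable complement of `sp_k{1−g}` in `P_{1,g}(A)`. Then for all
`x ∈ V_g` one has `x² = 0` and `gx = −xg`. -/
theorem complement_square_zero_and_anticommute
    (k : Type u) [Field k] [IsAlgClosed k] [CharZero k]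
    (A : Type v) [Ring A] [HopfAlgebra k A]
    (Q : QuasiTriangular k A) (htri : Q.IsTriangular) (hmin : Q.IsMinimal)
    (hpointed : IsPointed k A)
    (g : A) (hg : IsGrouplike k A g)
    (V : Submodule k A) (hV : IsConjStableComplement k A g V) :
    ∀ x ∈ V, x * x = 0 ∧ g * x = -(x * g) := by


  have hfd : FiniteDimensional k A := QuasiTriangular.finiteDimensional htri hmin
  obtain ⟨hVP, hdisj, -, hstable⟩ := hV
  intro x hxV
  have hxΔ : Coalgebra.comul (R := k) x = x ⊗ₜ[k] 1 + g ⊗ₜ[k] x :=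
    mem_skewPrimitives_iff.1 (hVP hxV)
  obtain ⟨χ, hχ⟩ := QuasiTriangular.exists_character htri hmin hg
  have hχg : χ g * χ g = 1 := htri.character_mul_character hχ hχ
  have hconj := QuasiTriangular.mul_slice_skewPrimitive (hVP hxV) hχ
  have hgS := hg.mul_antipode
  have hmem : χ x • (1 - g) = 0 := by
    have hV' : χ x • (1 - g) ∈ V := by
      have hz : x - χ g • (g * x * HopfAlgebra.antipode k g) = χ x • (1 - g) := by
        have h1 := congrArg (· * HopfAlgebra.antipode k g) hconj
        simp only [add_mul, mul_add, mul_smul_comm, smul_mul_assoc, mul_one, mul_assoc, hgS] at h1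
        rw [mul_assoc, smul_sub, sub_eq_sub_iff_add_eq_add, h1]
      rw [← hz]
      exact V.sub_mem hxV (V.smul_mem _ (hstable x hxV))
    exact Submodule.disjoint_def.1 hdisj _
      (Submodule.smul_mem _ _ (Submodule.mem_span_singleton_self _)) hV'
  have hxg : x * g = χ g • (g * x) := by
    have h1 : χ x • g = χ x • (1 : A) := (sub_eq_zero.1 (by rw [← smul_sub]; exact hmem)).symm
    have h2 : x * g + χ x • g = χ x • g + χ g • (g * x) := by
      have h3 := hconj
      rw [h1] at h3
      simpa [add_mul, mul_add] using h3
    rw [add_comm] at h2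
    exact add_left_cancel h2
  rcases mul_self_eq_one_iff.1 hχg with h1 | h1
  · have hx0 : x = 0 := Submodule.disjoint_def.1 hdisj x
      (mem_span_one_sub_of_commute hg hxΔ (by rw [h1, one_smul] at hxg; exact hxg.symm)
        (Algebra.IsIntegral.isIntegral x)) hxV
    simp [hx0]
  · rw [h1, neg_one_smul] at hxg
    have hgx : g * x = -(x * g) := by rw [hxg, neg_neg]
    refine ⟨?_, hgx⟩
    have hcomm : Commute (g ^ 2) (x * x) := by
      have : Commute (g ^ 2) x := by
        rw [Commute, SemiconjBy, pow_two, mul_assoc, hgx, mul_neg, ← mul_assoc, hgx, neg_mul,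
          neg_neg, mul_assoc]
      exact this.mul_right this
    have hΔ : Coalgebra.comul (R := k) (x * x) = (x * x) ⊗ₜ[k] 1 + (g ^ 2) ⊗ₜ[k] (x * x) := by
      rw [Bialgebra.comul_mul, hxΔ]
      simp only [add_mul, mul_add, Algebra.TensorProduct.tmul_mul_tmul, mul_one, one_mul, hgx,
        TensorProduct.neg_tmul, pow_two]
      abel
    obtain ⟨c, hc⟩ := Submodule.mem_span_singleton.1
      (mem_span_one_sub_of_commute (hg.pow 2) hΔ hcomm (Algebra.IsIntegral.isIntegral _))
    by_cases hc0 : c = 0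
    · rw [← hc, hc0, zero_smul]
    have hg2 : g ^ 2 = 1 := by
      refine QuasiTriangular.sq_eq_one_of_character htri hmin hpointed hg hχ fun h hh => ?_
      obtain ⟨η, hη⟩ := QuasiTriangular.exists_character htri hmin hh
      have hηχ := htri.character_mul_character hχ hη
      have hηg : η g ≠ 0 := left_ne_zero_of_mul_eq_one hηχ
      have hηx : η x = 0 := by
        have h2 := congrArg η hgx
        rw [map_neg, map_mul, map_mul, mul_comm (η x), eq_neg_iff_add_eq_zero, ← two_mul] at h2
        simpa [hηg] using h2
      have hηg2 : η g ^ 2 = 1 := by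
        have h2 := congrArg η hc
        rw [map_mul, hηx, mul_zero, map_smul, map_sub, map_one, map_pow, smul_eq_mul] at h2
        exact (sub_eq_zero.1 ((mul_eq_zero.1 h2).resolve_left hc0)).symm
      calc χ h ^ 2 = η g ^ 2 * χ h ^ 2 := by rw [hηg2, one_mul]
        _ = 1 := by rw [← mul_pow, hηχ, one_pow]
    rw [← hc, hg2, sub_self, smul_zero]

end Paper
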